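/- Let G be the series composition of multigraphs G1 and G2 at a vertex x, let a ∈ V1 \ {x}, let s, t, b ∈ V2 \ {x} be pairwise distinct, and let r_a, r_s, r_t, r_b ∈ ℤ with r_a + r_s + r_t + r_b = 0. Then mincost(G, [a ↦ r_a, s ↦ r_s, t ↦ r_t, b ↦ r_b]) = mincost(G1, [a ↦ r_a, x ↦ −r_a]) + mincost(G2, [x ↦ r_a, s ↦ r_s, t ↦ r_t, b ↦ r_b]), where the addition is in ℕ∞. -/

import Mathlib

open scoped BigOperators

/-- An undirected multigraph on vertex type `V` with edge type `E`:
each edge has a reference orientation `src e → tgt e`, a cost `c e` and a capacity `u e`. -/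
structure Multigraph (V E : Type) where
  src : E → V
  tgt : E → V
  c : E → ℕ
  u : E → ℕ

variable {V E : Type}

/-- The residue of a flow assignment `f : E → ℤ` at a vertex `v`:
inflow (w.r.t. the reference orientation) minus outflow. -/
def Multigraph.residue [Fintype E] [DecidableEq V] (G : Multigraph V E)
    (f : E → ℤ) (v : V) : ℤ :=
  (∑ e : E, if G.tgt e = v then f e else 0) - (∑ e : E, if G.src e = v then f e else 0)

/-- `f` is an `r`-circulation supported on `F`: it vanishes outside `F`,
respects capacities, and has residue `r v` at every vertex `v`. -/
def Multigraph.IsCirculation [Fintype E] [DecidableEq V] (G : Multigraph V E)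
    (r : V → ℤ) (F : Finset E) (f : E → ℤ) : Prop :=
  (∀ e, e ∉ F → f e = 0) ∧ (∀ e, |f e| ≤ (G.u e : ℤ)) ∧ (∀ v, G.residue f v = r v)

/-- The minimum cost (in `ℕ∞`) of a subset `F` of the allowed edge set `E'`
admitting an `r`-circulation supported on `F`.  Taking `E' = Finset.univ`
gives `mincost(G, r)`; taking `E' = E₁` for a sub-multigraph `(V₁, E₁)` all of
whose edges have both endpoints in `V₁` gives `mincost(G₁, r)` whenever `r`
vanishes outside `V₁`. -/
noncomputable def Multigraph.mincostOn [Fintype E] [DecidableEq V] (G : Multigraph V E)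
    (E' : Finset E) (r : V → ℤ) : ℕ∞ :=
  ⨅ (F : Finset E) (_ : F ⊆ E' ∧ ∃ f : E → ℤ, G.IsCirculation r F f),
    ((∑ e ∈ F, G.c e : ℕ) : ℕ∞)

namespace Multigraph

theorem residue_add [Fintype E] [DecidableEq V] (G : Multigraph V E) (f g : E → ℤ) (v : V) :
    G.residue (fun e => f e + g e) v = G.residue f v + G.residue g v := by
  simp only [residue, ← Finset.sum_filter, Finset.sum_add_distrib]
  ring

theorem sum_residue [Fintype V] [Fintype E] [DecidableEq V] (G : Multigraph V E) (f : E → ℤ) :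
    ∑ v, G.residue f v = 0 := by
  simp only [residue, Finset.sum_sub_distrib]
  rw [Finset.sum_comm, Finset.sum_comm (f := fun v e => if G.src e = v then f e else 0)]
  simp

/-- The residue vanishes outside any vertex set spanning the support of the flow. -/
theorem residue_eq_zero [Fintype E] [DecidableEq V] (G : Multigraph V E) {f : E → ℤ}
    {W : Finset V} {F : Finset E} (hf : ∀ e, e ∉ F → f e = 0)
    (hF : ∀ e ∈ F, G.src e ∈ W ∧ G.tgt e ∈ W) {v : V} (hv : v ∉ W) : G.residue f v = 0 := by
  have key (p : E → V) (hp : ∀ e ∈ F, p e ∈ W) : ∑ e, (if p e = v then f e else 0) = 0 := by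
    refine Finset.sum_eq_zero fun e _ => ?_
    split_ifs with h
    · exact hf e fun he => hv (h ▸ hp e he)
    · rfl
  rw [residue, key G.tgt fun e he => (hF e he).2, key G.src fun e he => (hF e he).1, sub_zero]

theorem mincostOn_le [Fintype E] [DecidableEq V] (G : Multigraph V E) {E' F : Finset E}
    {r : V → ℤ} {f : E → ℤ} (hF : F ⊆ E') (hf : G.IsCirculation r F f) :
    G.mincostOn E' r ≤ ((∑ e ∈ F, G.c e : ℕ) : ℕ∞) :=
  iInf₂_le F ⟨hF, f, hf⟩

/-- A finite minimum cost is attained. -/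
theorem exists_mincostOn_eq [Fintype E] [DecidableEq V] (G : Multigraph V E) {E' : Finset E}
    {r : V → ℤ} (h : G.mincostOn E' r ≠ ⊤) :
    ∃ F ⊆ E', ∃ f, G.IsCirculation r F f ∧
      G.mincostOn E' r = ((∑ e ∈ F, G.c e : ℕ) : ℕ∞) := by
  obtain ⟨F, hF⟩ := exists_eq_ciInf_of_finite (f := fun F : Finset E =>
    ⨅ _ : F ⊆ E' ∧ ∃ f : E → ℤ, G.IsCirculation r F f, ((∑ e ∈ F, G.c e : ℕ) : ℕ∞))
  change _ = G.mincostOn E' r at hF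
  by_cases hp : F ⊆ E' ∧ ∃ f : E → ℤ, G.IsCirculation r F f
  · rw [iInf_pos hp] at hF
    obtain ⟨hs, f, hf⟩ := hp
    exact ⟨F, hs, f, hf, hF.symm⟩
  · rw [iInf_neg hp] at hF
    exact absurd hF.symm h

/-- Minimum costs add up along a series composition, whenever the residue function splits into
one part on each side and the part on the first side is balanced. -/
theorem mincostOn_series [Fintype V] [Fintype E] [DecidableEq V] [DecidableEq E]
    (G : Multigraph V E) {V1 V2 : Finset V} {E1 E2 : Finset E}
    (hE : E1 ∪ E2 = Finset.univ) (hEdisj : Disjoint E1 E2)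
    (hG1 : ∀ e ∈ E1, G.src e ∈ V1 ∧ G.tgt e ∈ V1)
    (hG2 : ∀ e ∈ E2, G.src e ∈ V2 ∧ G.tgt e ∈ V2)
    {x : V} (hVx : V1 ∩ V2 = {x}) {r r1 r2 : V → ℤ} (hr : ∀ v, r v = r1 v + r2 v)
    (hr1 : ∀ v, v ∉ V1 → r1 v = 0) (hr2 : ∀ v, v ∉ V2 → r2 v = 0) (hsum : ∑ v, r1 v = 0) :
    G.mincostOn Finset.univ r = G.mincostOn E1 r1 + G.mincostOn E2 r2 := by
  have hmem (e : E) : e ∈ E1 ∨ e ∈ E2 := by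
    rw [← Finset.mem_union, hE]
    exact Finset.mem_univ e
  have hnot (e : E) : e ∈ E1 → e ∉ E2 := fun h => Finset.disjoint_left.mp hEdisj h
  apply le_antisymm
  · by_cases h1 : G.mincostOn E1 r1 = ⊤
    · simp [h1]
    by_cases h2 : G.mincostOn E2 r2 = ⊤
    · simp [h2]
    obtain ⟨F1, hF1, f1, ⟨hs1, hu1, hv1⟩, e1⟩ := G.exists_mincostOn_eq h1
    obtain ⟨F2, hF2, f2, ⟨hs2, hu2, hv2⟩, e2⟩ := G.exists_mincostOn_eq h2
    rw [e1, e2, ← Nat.cast_add,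
      ← Finset.sum_union (Finset.disjoint_of_subset_left hF1
        (Finset.disjoint_of_subset_right hF2 hEdisj))]
    refine G.mincostOn_le (f := fun e => f1 e + f2 e) (Finset.subset_univ _)
      ⟨fun e he => ?_, fun e => ?_, fun v => ?_⟩
    · dsimp only
      rw [Finset.mem_union, not_or] at he
      rw [hs1 e he.1, hs2 e he.2, add_zero]
    · dsimp only
      rcases hmem e with h | h
      · rw [hs2 e fun h' => hnot e h (hF2 h'), add_zero]
        exact hu1 e
      · rw [hs1 e fun h' => hnot e (hF1 h') h, zero_add]
        exact hu2 e
    · rw [residue_add, hv1, hv2, hr]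
  · refine le_iInf₂ fun F ⟨_, f, hs, hu, hv⟩ => ?_
    set f1 : E → ℤ := fun e => if e ∈ E1 then f e else 0 with hf1
    set f2 : E → ℤ := fun e => if e ∈ E2 then f e else 0 with hf2
    have hadd (v : V) : G.residue f1 v + G.residue f2 v = r1 v + r2 v := by
      rw [← hr, ← hv, ← residue_add]
      congr 1
      ext e
      have := hmem e
      have := hnot e
      simp only [hf1, hf2]
      grind
    have hz1 (v : V) (h : v ∉ V1) : G.residue f1 v = 0 :=
      G.residue_eq_zero (fun e he => if_neg he) hG1 h
    have hz2 (v : V) (h : v ∉ V2) : G.residue f2 v = 0 :=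
      G.residue_eq_zero (fun e he => if_neg he) hG2 h
    have hne (v : V) (h : v ≠ x) : G.residue f1 v = r1 v := by
      by_cases h1 : v ∈ V1
      · have h2 : v ∉ V2 := fun h2 => h <| by
          rw [← Finset.mem_singleton, ← hVx]
          exact Finset.mem_inter.mpr ⟨h1, h2⟩
        have := hadd v
        rw [hz2 v h2, hr2 v h2] at this
        simpa using this
      · rw [hz1 v h1, hr1 v h1]
    have hres1 (v : V) : G.residue f1 v = r1 v := by
      by_cases h : v = x
      · have hdiff : ∑ w, (G.residue f1 w - r1 w) = 0 := by
          rw [Finset.sum_sub_distrib, sum_residue, hsum, sub_zero]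
        rw [Fintype.sum_eq_single x fun w hw => sub_eq_zero.mpr (hne w hw)] at hdiff
        rw [h]
        exact sub_eq_zero.mp hdiff
      · exact hne v h
    have hres2 (v : V) : G.residue f2 v = r2 v := by
      have := hadd v
      rw [hres1] at this
      exact add_left_cancel this
    have hcirc {D : Finset E} {q : V → ℤ}
        (hq : ∀ v, G.residue (fun e => if e ∈ D then f e else 0) v = q v) :
        G.IsCirculation q (F ∩ D) (fun e => if e ∈ D then f e else 0) := by
      refine ⟨fun e he => ?_, fun e => ?_, hq⟩
      · dsimp only
        split_ifs with h
        · exact hs e fun h' => he (Finset.mem_inter.mpr ⟨h', h⟩)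
        · rfl
      · dsimp only
        split_ifs
        · exact hu e
        · simp
    have hF : F = F ∩ E1 ∪ F ∩ E2 := by
      rw [← Finset.inter_union_distrib_left, hE, Finset.inter_univ]
    calc G.mincostOn E1 r1 + G.mincostOn E2 r2
        ≤ ((∑ e ∈ F ∩ E1, G.c e : ℕ) : ℕ∞) + ((∑ e ∈ F ∩ E2, G.c e : ℕ) : ℕ∞) :=
          add_le_add (G.mincostOn_le Finset.inter_subset_right (hcirc hres1))
            (G.mincostOn_le Finset.inter_subset_right (hcirc hres2))
      _ = ((∑ e ∈ F, G.c e : ℕ) : ℕ∞) := by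
          rw [← Nat.cast_add, ← Finset.sum_union (Finset.disjoint_of_subset_left
            Finset.inter_subset_right (Finset.disjoint_of_subset_right
              Finset.inter_subset_right hEdisj)), ← hF]

end Multigraph

/-- Case 3.3: series composition not splitting `s` and `t` into different subgraphs. -/
theorem series_four_tuple_no_split {V E : Type}
    [Fintype V] [Fintype E] [DecidableEq V] [DecidableEq E]
    (G : Multigraph V E) (V1 V2 : Finset V) (E1 E2 : Finset E)
    (hE : E1 ∪ E2 = Finset.univ) (hEdisj : Disjoint E1 E2)
    (hV : V1 ∪ V2 = Finset.univ)
    (hG1 : ∀ e ∈ E1, G.src e ∈ V1 ∧ G.tgt e ∈ V1)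
    (hG2 : ∀ e ∈ E2, G.src e ∈ V2 ∧ G.tgt e ∈ V2)
    (x a s t b : V) (hVx : V1 ∩ V2 = {x})
    (ha : a ∈ V1) (hax : a ≠ x)
    (hs : s ∈ V2) (hsx : s ≠ x) (ht : t ∈ V2) (htx : t ≠ x) (hb : b ∈ V2) (hbx : b ≠ x)
    (hst : s ≠ t) (hsb : s ≠ b) (htb : t ≠ b)
    (ra rs rt rb : ℤ) (hsum : ra + rs + rt + rb = 0) :
    G.mincostOn Finset.univ
        (fun v => if v = a then ra else if v = s then rs else if v = t then rt
          else if v = b then rb else 0) =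
      G.mincostOn E1 (fun v => if v = a then ra else if v = x then -ra else 0) +
      G.mincostOn E2
        (fun v => if v = x then ra else if v = s then rs else if v = t then rt
          else if v = b then rb else 0) := by
  have hx : x ∈ V1 ∩ V2 := by simp [hVx]
  have hcut (v : V) (h1 : v ∈ V1) (h2 : v ∈ V2) : v = x := by
    rw [← Finset.mem_singleton, ← hVx]
    exact Finset.mem_inter.mpr ⟨h1, h2⟩
  have haV : a ∉ V2 := fun h => hax (hcut a ha h)
  rw [Finset.mem_inter] at hx
  apply G.mincostOn_series hE hEdisj hG1 hG2 hVx
  · grind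
  · grind
  · grind
  · rw [Fintype.sum_eq_add a x hax fun v hv => by simp [hv.1, hv.2]]
    simp [hax.symm]
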